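/- Let p ∈ ℕ, β > 0, 0 < σ_min ≤ σ_max, L_f, L_μ, L_σ ≥ 0. Let f, μ, σ : ℝ^p → ℝ^p satisfy: f is L_f-Lipschitz; μ is L_μ-Lipschitz; ‖σ(s) − σ(s')‖ ≤ L_σ·‖s − s'‖ for all s, s'; σ_min ≤ σ(s)_i ≤ σ_max for all s and i; and |f(s)_i − μ(s)_i| ≤ β·σ(s)_i for all s and i. Define η : ℝ^p → ℝ^p by η(s)_i = (f(s)_i − μ(s)_i)/(β·σ(s)_i). Then |η(s)_i| ≤ 1 for all s and i, and η is Lipschitz: ‖η(s) − η(s')‖ ≤ ( √p·(L_f + L_μ)/(β·σ_min) + √p·σ_max·L_σ/σ_min² )·‖s − s'‖ for all s, s' ∈ ℝ^p. -/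

import Mathlib

/-- A vector of `ℝ^p` whose coordinates are bounded by `C` has Euclidean norm at most `√p C`. -/
theorem EuclideanSpace.norm_le_sqrt_card_mul {p : ℕ} (x : EuclideanSpace ℝ (Fin p)) {C : ℝ}
    (hC : 0 ≤ C) (hx : ∀ i, |x i| ≤ C) : ‖x‖ ≤ √p * C := by
  rw [EuclideanSpace.norm_eq]
  calc √(∑ i, ‖x i‖ ^ 2) ≤ √(∑ _i : Fin p, C ^ 2) := by
        gcongr with i
        exact hx i
    _ = √p * C := by simp [Real.sqrt_sq hC]

/-- A perturbation bound for the calibrated quotient with numerator d and denominator β s. -/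
theorem abs_div_sub_div_le {β m d d' s s' D S : ℝ} (hβ : 0 < β) (hm : 0 < m) (hs : m ≤ s)
    (hs' : 0 < s') (hd' : |d'| ≤ β * s') (hD : |d - d'| ≤ D) (hS : |s - s'| ≤ S) :
    |d / (β * s) - d' / (β * s')| ≤ D / (β * m) + S / m := by
  have hs0 : 0 < s := hm.trans_le hs
  have hD0 : 0 ≤ D := (abs_nonneg _).trans hD
  have hS0 : 0 ≤ S := (abs_nonneg _).trans hS
  have hq : |d' / (β * s')| ≤ 1 := by
    rw [abs_div, abs_of_pos (mul_pos hβ hs')]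
    exact div_le_one_of_le₀ hd' (by positivity)
  have key : d / (β * s) - d' / (β * s') =
      (d - d') / (β * s) - d' / (β * s') * ((s - s') / s) := by
    field_simp
    ring
  rw [key]
  refine (abs_sub _ _).trans (add_le_add ?_ ?_)
  · rw [abs_div, abs_of_pos (mul_pos hβ hs0)]
    gcongr
  · rw [abs_mul, abs_div (s - s'), abs_of_pos hs0]
    calc _ ≤ 1 * (|s - s'| / s) := by gcongr
      _ ≤ S / m := by
        rw [one_mul]
        gcongr

/-- The hallucination function `η(s)ᵢ = (f(s)ᵢ − μ(s)ᵢ)/(β σ(s)ᵢ)` of a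
`β`-calibrated model with uncertainty bounded in `[σ_min, σ_max]`, `σ_min > 0`, takes values
in `[-1,1]` coordinatewise and is Lipschitz with constant
`√p (L_f + L_μ)/(β σ_min) + √p σ_max L_σ / σ_min²`. -/
theorem hallucination_lipschitz (p : ℕ) (β σmin σmax Lf Lμ Lσ : ℝ)
    (hβ : 0 < β) (hσmin : 0 < σmin) (hσ : σmin ≤ σmax)
    (hLf : 0 ≤ Lf) (hLμ : 0 ≤ Lμ) (hLσ : 0 ≤ Lσ)
    (f μ σ η : EuclideanSpace ℝ (Fin p) → EuclideanSpace ℝ (Fin p))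
    (hfLip : ∀ a b, ‖f a - f b‖ ≤ Lf * ‖a - b‖)
    (hμLip : ∀ a b, ‖μ a - μ b‖ ≤ Lμ * ‖a - b‖)
    (hσLip : ∀ a b, ‖σ a - σ b‖ ≤ Lσ * ‖a - b‖)
    (hbounds : ∀ (s : EuclideanSpace ℝ (Fin p)) (i : Fin p),
      σmin ≤ σ s i ∧ σ s i ≤ σmax)
    (hcal : ∀ (s : EuclideanSpace ℝ (Fin p)) (i : Fin p), |f s i - μ s i| ≤ β * σ s i)
    (hηdef : ∀ (s : EuclideanSpace ℝ (Fin p)) (i : Fin p),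
      η s i = (f s i - μ s i) / (β * σ s i)) :
    (∀ (s : EuclideanSpace ℝ (Fin p)) (i : Fin p), |η s i| ≤ 1) ∧
    (∀ a b, ‖η a - η b‖ ≤
      (Real.sqrt p * (Lf + Lμ) / (β * σmin) + Real.sqrt p * σmax * Lσ / σmin ^ 2) *
        ‖a - b‖) := by
  have hσpos : ∀ s i, 0 < σ s i := fun s i => hσmin.trans_le (hbounds s i).1
  have hcoord : ∀ (g : EuclideanSpace ℝ (Fin p) → EuclideanSpace ℝ (Fin p)) a b i,
      |g a i - g b i| ≤ ‖g a - g b‖ := fun g a b i => by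
    simpa using PiLp.norm_apply_le (g a - g b) i
  refine ⟨fun s i => ?_, fun a b => ?_⟩
  · have hpos := mul_pos hβ (hσpos s i)
    rw [hηdef, abs_div, abs_of_pos hpos]
    exact div_le_one_of_le₀ (hcal s i) hpos.le
  · have hσmax : 0 < σmax := hσmin.trans_le hσ
    have hfactor : √p * (Lf + Lμ) / (β * σmin) + √p * σmax * Lσ / σmin ^ 2 =
        √p * ((Lf + Lμ) / (β * σmin) + σmax * Lσ / σmin ^ 2) := by ring
    rw [hfactor, mul_assoc]
    refine EuclideanSpace.norm_le_sqrt_card_mul _ (by positivity) fun i => ?_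
    rw [PiLp.sub_apply, hηdef, hηdef]
    have hD : |(f a i - μ a i) - (f b i - μ b i)| ≤ (Lf + Lμ) * ‖a - b‖ := by
      rw [sub_sub_sub_comm, add_mul]
      exact (abs_sub _ _).trans (add_le_add ((hcoord f a b i).trans (hfLip a b))
        ((hcoord μ a b i).trans (hμLip a b)))
    have hS : |σ a i - σ b i| ≤ Lσ * ‖a - b‖ := (hcoord σ a b i).trans (hσLip a b)
    refine (abs_div_sub_div_le hβ hσmin (hbounds a i).1 (hσpos b i) (hcal b i) hD hS).trans ?_
    rw [add_mul (_ / _), div_mul_eq_mul_div, div_mul_eq_mul_div]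
    refine add_le_add le_rfl ?_
    calc Lσ * ‖a - b‖ / σmin = σmin * Lσ * ‖a - b‖ / σmin ^ 2 := by field_simp
      _ ≤ σmax * Lσ * ‖a - b‖ / σmin ^ 2 := by gcongr
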